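/- In the nef-partition setting, the map σ* ↦ σ̌ defines an order-preserving bijection from R_{Δ*} = {proper faces σ* of Δ* with σ̌ ≠ ∅} to P_∇ = {faces σ̌ of ∇ arising this way}, and the map σ* ↦ σ̌* defines an order-reversing bijection between R_{Δ*} and R_{∇*}. -/

import Mathlib

open scoped Pointwise

namespace BB

abbrev V (n : ℕ) : Type := Fin n → ℝ

/-- The standard pairing between `M_ℝ` and `N_ℝ` (both identified with `ℝⁿ`). -/
def pair {n : ℕ} (m v : V n) : ℝ := ∑ i, m i * v i

/-- A point of `ℝⁿ` is a lattice point if all its coordinates are integers. -/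
def IsLatticePt {n : ℕ} (m : V n) : Prop := ∀ i, ∃ z : ℤ, m i = (z : ℝ)

/-- A lattice polytope: convex hull of finitely many lattice points. -/
def IsLatticePolytope {n : ℕ} (P : Set (V n)) : Prop :=
  ∃ S : Finset (V n), (∀ m ∈ S, IsLatticePt m) ∧ P = convexHull ℝ (S : Set (V n))

/-- The polar dual `P* = {v | ⟨m,v⟩ ≥ -1 for all m ∈ P}`. -/
def polar {n : ℕ} (P : Set (V n)) : Set (V n) := {v | ∀ m ∈ P, -1 ≤ pair m v}

/-- A reflexive polytope: a lattice polytope with `0` in its interior whose polar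
dual is again a lattice polytope. -/
def IsReflexive {n : ℕ} (P : Set (V n)) : Prop :=
  IsLatticePolytope P ∧ (0 : V n) ∈ interior P ∧ IsLatticePolytope (polar P)

/-- The support function `supp P v = -inf{⟨m,v⟩ | m ∈ P}`; for `P = Δᵢ` and `v ∈ N_ℝ`
this is the piecewise linear function `φᵢ(v)` of the nef-partition. -/
noncomputable def supp {n : ℕ} (P : Set (V n)) (v : V n) : ℝ :=
  sSup ((fun m => -(pair m v)) '' P)

end BB


namespace BB

/-- `F` is a face of the convex set `P` (an exposed subset). -/
def IsFaceOf {n : ℕ} (F P : Set (V n)) : Prop := IsExposed ℝ P F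

/-- For a family of polytopes `D` and a set `F`, the Minkowski sum
`∑ᵢ {v ∈ F | suppᵢ(v) = 1}`; applied to faces of `Δ*` this is `σ* ↦ σ̌`. -/
noncomputable def chkMap {n r : ℕ} (D : Fin r → Set (V n)) (F : Set (V n)) : Set (V n) :=
  ∑ i, {v ∈ F | supp (D i) v = 1}

section Pairing

variable {n : ℕ}

theorem pair_comm (m v : V n) : pair m v = pair v m := dotProduct_comm m v

theorem pair_smul_left (c : ℝ) (m v : V n) : pair (c • m) v = c * pair m v :=
  smul_dotProduct c m v

theorem pair_smul_right (c : ℝ) (m v : V n) : pair m (c • v) = c * pair m v :=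
  dotProduct_smul c m v

theorem pair_sum_left {ι : Type*} (s : Finset ι) (m : ι → V n) (v : V n) :
    pair (∑ i ∈ s, m i) v = ∑ i ∈ s, pair (m i) v := sum_dotProduct s m v

theorem pair_sum_right {ι : Type*} (s : Finset ι) (m : V n) (v : ι → V n) :
    pair m (∑ i ∈ s, v i) = ∑ i ∈ s, pair m (v i) := dotProduct_sum m s v

theorem pair_zero_left (v : V n) : pair 0 v = 0 := zero_dotProduct v

theorem pair_zero_right (m : V n) : pair m 0 = 0 := dotProduct_zero m

/-- The continuous linear functional `⟨·, v⟩`. -/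
noncomputable def pairCLM (v : V n) : V n →L[ℝ] ℝ :=
  LinearMap.toContinuousLinearMap
    { toFun := fun m => pair m v
      map_add' := fun a b => add_dotProduct a b v
      map_smul' := fun c a => smul_dotProduct c a v }

theorem pairCLM_apply (m v : V n) : pairCLM v m = pair m v := rfl

theorem exists_pair_eq (l : V n →L[ℝ] ℝ) : ∃ m : V n, ∀ v, l v = pair m v := by
  refine ⟨fun i => l (fun j => if i = j then 1 else 0), fun v => ?_⟩
  have := LinearMap.pi_apply_eq_sum_univ (l : V n →ₗ[ℝ] ℝ) v
  simp only [ContinuousLinearMap.coe_coe, smul_eq_mul] at this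
  rw [this]
  exact Finset.sum_congr rfl fun i _ => mul_comm _ _

theorem mem_of_forall_exists_pair_le {K : Set (V n)} (hK : IsCompact K) (hc : Convex ℝ K)
    {m : V n} (h : ∀ v, ∃ k ∈ K, pair k v ≤ pair m v) : m ∈ K := by
  by_contra hm
  obtain ⟨l, u, hlu, hl⟩ := geometric_hahn_banach_point_closed hc hK.isClosed hm
  obtain ⟨v, hv⟩ := exists_pair_eq l
  obtain ⟨k, hk, hkm⟩ := h v
  have h1 := hl k hk
  rw [hv, pair_comm] at h1 hlu
  linarith

theorem isFaceOf_setOf_pair_eq_neg_one {P S : Set (V n)}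
    (h : ∀ m ∈ P, ∀ s ∈ S, -1 ≤ pair m s) :
    IsFaceOf {m ∈ P | ∀ v ∈ S, pair m v = -1} P := by
  rintro ⟨m₁, hm₁P, hm₁⟩
  obtain ⟨T, hTS, hT⟩ := (Submodule.fg_span_iff_fg_span_finset_subset (R := ℝ) S).1
    (IsNoetherian.noetherian _)
  refine ⟨-∑ s ∈ T, pairCLM s, ?_⟩
  have hl : ∀ m, (-∑ s ∈ T, pairCLM s) m = -∑ s ∈ T, pair m s := fun m => by
    simp [pairCLM_apply]
  ext m
  simp only [Set.mem_ofPred_eq, hl, neg_le_neg_iff]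
  refine and_congr_right fun hmP => ⟨fun hm y hy => ?_, fun hm v hv => ?_⟩
  · refine Finset.sum_le_sum fun s hs => ?_
    rw [hm s (hTS hs)]
    exact h y hy s (hTS hs)
  · have hle := hm m₁ hm₁P
    have heq : ∀ s ∈ T, pair m₁ s = pair m s :=
      (Finset.sum_eq_sum_iff_of_le fun s hs => by
        rw [hm₁ s (hTS hs)]; exact h m hmP s (hTS hs)).1
        (le_antisymm (Finset.sum_le_sum fun s hs => by
          rw [hm₁ s (hTS hs)]; exact h m hmP s (hTS hs)) hle)
    have hvT : v ∈ Submodule.span ℝ (T : Set (V n)) := hT ▸ Submodule.subset_span hv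
    have hvanish : ∀ x ∈ Submodule.span ℝ (T : Set (V n)), pair m₁ x = pair m x := fun x hx => by
      induction hx using Submodule.span_induction with
      | mem s hs => exact heq s hs
      | zero => rw [pair_zero_right, pair_zero_right]
      | add a b _ _ ha hb =>
        exact (dotProduct_add m₁ a b).trans
          ((congrArg₂ (· + ·) ha hb).trans (dotProduct_add m a b).symm)
      | smul c a _ ha => rw [pair_smul_right, pair_smul_right, ha]
    rw [← hvanish v hvT, hm₁ v hv]

end Pairing

theorem zero_mem_polar {n : ℕ} (P : Set (V n)) : (0 : V n) ∈ polar P := fun m _ => by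
  rw [pair_zero_right]; norm_num

section Support

variable {n : ℕ} {P : Set (V n)}

theorem continuous_pair_left (v : V n) : Continuous fun m : V n => pair m v :=
  (pairCLM v).continuous

theorem neg_pair_le_supp (hP : IsCompact P) {m : V n} (hm : m ∈ P) (v : V n) :
    -(pair m v) ≤ supp P v :=
  le_csSup (hP.image (continuous_pair_left v).neg).bddAbove ⟨m, hm, rfl⟩

theorem exists_neg_pair_eq_supp (hP : IsCompact P) (hne : P.Nonempty) (v : V n) :
    ∃ m ∈ P, -(pair m v) = supp P v :=
  (hP.image (continuous_pair_left v).neg).sSup_mem (hne.image _)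

theorem supp_smul (hP : IsCompact P) (hne : P.Nonempty) {c : ℝ} (hc : 0 ≤ c) (v : V n) :
    supp P (c • v) = c * supp P v := by
  obtain ⟨m, hm, hmv⟩ := exists_neg_pair_eq_supp hP hne (c • v)
  obtain ⟨k, hk, hkv⟩ := exists_neg_pair_eq_supp hP hne v
  have h1 := neg_pair_le_supp hP hm v
  have h2 := neg_pair_le_supp hP hk (c • v)
  rw [pair_smul_right] at hmv h2
  nlinarith

theorem supp_sum_smul_le (hP : IsCompact P) (hne : P.Nonempty) {ι : Type*} (s : Finset ι)
    {c : ι → ℝ} (hc : ∀ i ∈ s, 0 ≤ c i) (v : ι → V n) :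
    supp P (∑ i ∈ s, c i • v i) ≤ ∑ i ∈ s, c i * supp P (v i) := by
  obtain ⟨m, hm, hmv⟩ := exists_neg_pair_eq_supp hP hne (∑ i ∈ s, c i • v i)
  rw [← hmv, pair_sum_right, ← Finset.sum_neg_distrib]
  refine Finset.sum_le_sum fun i hi => ?_
  rw [pair_smul_right, ← mul_neg]
  exact mul_le_mul_of_nonneg_left (neg_pair_le_supp hP hm _) (hc i hi)

theorem mem_sum_iff {r : ℕ} {D : Fin r → Set (V n)} {m : V n} :
    m ∈ ∑ i, D i ↔ ∃ d : Fin r → V n, (∀ i, d i ∈ D i) ∧ ∑ i, d i = m := by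
  rw [Set.mem_fintype_sum]
  exact ⟨fun ⟨d, hd, h⟩ => ⟨d, fun i => hd i, h⟩, fun ⟨d, hd, h⟩ => ⟨d, fun {i} => hd i, h⟩⟩

theorem mem_polar_sum_iff {r : ℕ} {D : Fin r → Set (V n)} (hD : ∀ i, IsCompact (D i))
    (hne : ∀ i, (D i).Nonempty) {v : V n} :
    v ∈ polar (∑ i, D i) ↔ ∑ i, supp (D i) v ≤ 1 := by
  constructor
  · intro hv
    choose d hd hdv using fun i => exists_neg_pair_eq_supp (hD i) (hne i) v
    have := hv _ (mem_sum_iff.2 ⟨d, hd, rfl⟩)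
    rw [pair_sum_left] at this
    rw [← Finset.sum_congr rfl fun i _ => hdv i, Finset.sum_neg_distrib]
    linarith
  · intro hv m hm
    obtain ⟨d, hd, rfl⟩ := mem_sum_iff.1 hm
    rw [pair_sum_left]
    have : ∑ i, -(pair (d i) v) ≤ ∑ i, supp (D i) v :=
      Finset.sum_le_sum fun i _ => neg_pair_le_supp (hD i) (hd i) v
    rw [Finset.sum_neg_distrib] at this
    linarith

end Support

/-- Dual families of compact convex sets: the properties of a nef-partition `D` and of its dual
`N` on which the face correspondence rests. They are symmetric in `D` and `N`. -/
structure NefDual {n r : ℕ} (D N : Fin r → Set (V n)) : Prop where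
  compact_left : ∀ i, IsCompact (D i)
  compact_right : ∀ i, IsCompact (N i)
  convex_left : ∀ i, Convex ℝ (D i)
  convex_right : ∀ i, Convex ℝ (N i)
  zero_left : ∀ i, (0 : V n) ∈ D i
  zero_right : ∀ i, (0 : V n) ∈ N i
  pairing : ∀ i j, ∀ m ∈ D i, ∀ v ∈ N j, -(if i = j then 1 else 0 : ℝ) ≤ pair m v
  decomp_left : ∀ m, ∃ d : Fin r → V n, (∀ j, d j ∈ D j) ∧ m = ∑ j, supp (N j) m • d j
  decomp_right : ∀ v, ∃ w : Fin r → V n, (∀ j, w j ∈ N j) ∧ v = ∑ j, supp (D j) v • w j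

/-- The proper faces `F` of the polar dual of `∑ᵢ Dᵢ` for which `chkMap D F` is nonempty. -/
def regularFaces {n r : ℕ} (D : Fin r → Set (V n)) : Set (Set (V n)) :=
  {F | IsFaceOf F (polar (∑ i, D i)) ∧ F ≠ polar (∑ i, D i) ∧ (chkMap D F).Nonempty}

/-- The face of the polar dual of `∑ᵢ Nᵢ` on which the pairing with `chkMap D F` is `-1`. -/
def dualFace {n r : ℕ} (D N : Fin r → Set (V n)) (F : Set (V n)) : Set (V n) :=
  {m ∈ polar (∑ i, N i) | ∀ v ∈ chkMap D F, pair m v = -1}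

theorem mem_chkMap_iff {n r : ℕ} {D : Fin r → Set (V n)} {F : Set (V n)} {v : V n} :
    v ∈ chkMap D F ↔
      ∃ w : Fin r → V n, (∀ i, w i ∈ F ∧ supp (D i) (w i) = 1) ∧ ∑ i, w i = v :=
  mem_sum_iff

theorem chkMap_mono {n r : ℕ} (D : Fin r → Set (V n)) {F G : Set (V n)} (h : F ⊆ G) :
    chkMap D F ⊆ chkMap D G := fun v hv => by
  obtain ⟨w, hw, rfl⟩ := mem_chkMap_iff.1 hv
  exact mem_chkMap_iff.2 ⟨w, fun i => ⟨h (hw i).1, (hw i).2⟩, rfl⟩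

theorem dualFace_anti {n r : ℕ} (D N : Fin r → Set (V n)) {F G : Set (V n)} (h : F ⊆ G) :
    dualFace D N G ⊆ dualFace D N F :=
  fun _ hm => ⟨hm.1, fun v hv => hm.2 v (chkMap_mono D h hv)⟩

namespace NefDual

variable {n r : ℕ} {D N : Fin r → Set (V n)}

theorem symm (h : NefDual D N) : NefDual N D where
  compact_left := h.compact_right
  compact_right := h.compact_left
  convex_left := h.convex_right
  convex_right := h.convex_left
  zero_left := h.zero_right
  zero_right := h.zero_left
  pairing := fun i j m hm v hv => by
    rw [pair_comm]
    simpa only [eq_comm] using h.pairing j i v hv m hm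
  decomp_left := h.decomp_right
  decomp_right := h.decomp_left

theorem supp_nonneg (h : NefDual D N) (i : Fin r) (v : V n) : 0 ≤ supp (D i) v := by
  have := neg_pair_le_supp (h.compact_left i) (h.zero_left i) v
  rwa [pair_zero_left, neg_zero] at this

theorem mem_polar_iff (h : NefDual D N) {v : V n} :
    v ∈ polar (∑ i, D i) ↔ ∑ i, supp (D i) v ≤ 1 :=
  mem_polar_sum_iff h.compact_left fun i => ⟨0, h.zero_left i⟩

theorem supp_le (h : NefDual D N) (i : Fin r) {j : Fin r} {v : V n} (hv : v ∈ N j) :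
    supp (D i) v ≤ if i = j then 1 else 0 := by
  obtain ⟨m, hm, hmv⟩ := exists_neg_pair_eq_supp (h.compact_left i) ⟨0, h.zero_left i⟩ v
  have := h.pairing i j m hm v hv
  linarith

theorem mem_polar (h : NefDual D N) {j : Fin r} {v : V n} (hv : v ∈ N j) :
    v ∈ polar (∑ i, D i) := by
  rw [h.mem_polar_iff]
  calc ∑ i, supp (D i) v ≤ ∑ i, if i = j then (1 : ℝ) else 0 :=
        Finset.sum_le_sum fun i _ => h.supp_le i hv
    _ = 1 := by simp

theorem supp_eq (h : NefDual D N) {j : Fin r} {v : V n} (hv : v ∈ polar (∑ i, D i))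
    (hj : supp (D j) v = 1) (i : Fin r) : supp (D i) v = if i = j then 1 else 0 := by
  split_ifs with hij
  · rw [hij, hj]
  · have h1 := h.mem_polar_iff.1 hv
    rw [← Finset.add_sum_erase _ _ (Finset.mem_univ j), hj] at h1
    have h2 : supp (D i) v ≤ ∑ k ∈ Finset.univ.erase j, supp (D k) v :=
      Finset.single_le_sum (f := fun k => supp (D k) v) (fun k _ => h.supp_nonneg k v)
        (Finset.mem_erase.2 ⟨hij, Finset.mem_univ i⟩)
    have := h.supp_nonneg i v
    linarith

theorem mem_right (h : NefDual D N) {j : Fin r} {v : V n} (hv : v ∈ polar (∑ i, D i))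
    (hj : supp (D j) v = 1) : v ∈ N j := by
  obtain ⟨w, hw, hvw⟩ := h.decomp_right v
  have : v = w j := by
    rw [hvw, Finset.sum_eq_single j]
    · rw [hj, one_smul]
    · intro i _ hij
      rw [h.supp_eq hv hj, if_neg hij, zero_smul]
    · simp
  exact this ▸ hw j

theorem mem_sum_of_forall (h : NefDual D N) {m : V n}
    (hm : ∀ v ∈ polar (∑ i, D i), -1 ≤ pair m v) : m ∈ ∑ i, D i := by
  obtain ⟨d, hd, hmd⟩ := h.decomp_left m
  refine mem_sum_iff.2 ⟨fun j => supp (N j) m • d j, fun j => ?_, hmd.symm⟩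
  refine (h.convex_left j).smul_mem_of_zero_mem (h.zero_left j) (hd j)
    ⟨h.symm.supp_nonneg j m, ?_⟩
  obtain ⟨v, hv, hvm⟩ := exists_neg_pair_eq_supp (h.compact_right j) ⟨0, h.zero_right j⟩ m
  have := hm v (h.mem_polar hv)
  rw [pair_comm] at hvm
  linarith

theorem exists_face_eq (h : NefDual D N) {F : Set (V n)} (hF : IsFaceOf F (polar (∑ i, D i)))
    (hne : F ≠ polar (∑ i, D i)) :
    ∃ d : Fin r → V n, (∀ i, d i ∈ D i) ∧
      F = {v ∈ polar (∑ i, D i) | pair (∑ i, d i) v = -1} := by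
  rcases F.eq_empty_or_nonempty with rfl | hFne
  · refine ⟨0, h.zero_left, ?_⟩
    ext v
    simp [pair_zero_left]
  obtain ⟨l, hl⟩ := hF hFne
  obtain ⟨x, hx⟩ := hFne
  have hx' := hx
  rw [hl] at hx'
  obtain ⟨hxP, hxmax⟩ := hx'
  have hpos : 0 < l x := by
    by_contra hle
    have hle0 : ∀ y ∈ polar (∑ i, D i), l y ≤ 0 := fun y hy =>
      (hxmax y hy).trans (not_lt.1 hle)
    have hle1 : ∀ y, l y ≤ 0 := fun y => by
      have ht : 0 ≤ ∑ i, supp (D i) y := Finset.sum_nonneg fun i _ => h.supp_nonneg i y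
      have ht' : 0 < 1 + ∑ i, supp (D i) y := by linarith
      have hmem : (1 + ∑ i, supp (D i) y)⁻¹ • y ∈ polar (∑ i, D i) := by
        rw [h.mem_polar_iff]
        simp_rw [supp_smul (h.compact_left _) ⟨0, h.zero_left _⟩ (inv_nonneg.2 ht'.le)]
        rw [← Finset.mul_sum, inv_mul_le_iff₀ ht']
        linarith
      have := hle0 _ hmem
      rw [map_smul, smul_eq_mul] at this
      exact nonpos_of_mul_nonpos_right this (inv_pos.2 ht')
    apply hne
    rw [hl]
    ext v
    simp only [Set.mem_ofPred_eq, and_iff_left_iff_imp]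
    intro _ y _
    have h1 := hle1 (-v)
    rw [map_neg] at h1
    linarith [hle1 y]
  obtain ⟨m, hm⟩ := exists_pair_eq l
  have hval : ∀ v, pair (-(l x)⁻¹ • m) v = -((l x)⁻¹ * l v) := fun v => by
    rw [pair_smul_left, hm v]; ring
  have hbound : ∀ v ∈ polar (∑ i, D i), -1 ≤ pair (-(l x)⁻¹ • m) v := fun v hv => by
    rw [hval, neg_le_neg_iff, inv_mul_le_iff₀ hpos, mul_one]
    exact hxmax v hv
  obtain ⟨d, hd, hdm⟩ := mem_sum_iff.1 (h.mem_sum_of_forall hbound)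
  refine ⟨d, hd, ?_⟩
  rw [hdm, hl]
  ext v
  simp only [Set.mem_ofPred_eq, hval, neg_inj]
  refine and_congr_right fun hv => ?_
  rw [inv_mul_eq_iff_eq_mul₀ hpos.ne', mul_one]
  exact ⟨fun hmax => le_antisymm (hxmax v hv) (hmax x hxP), fun heq y hy => heq ▸ hxmax y hy⟩

theorem exists_convex_comb (h : NefDual D N) {d : Fin r → V n} (hd : ∀ i, d i ∈ D i)
    {v : V n} (hv : v ∈ polar (∑ i, D i)) (hvd : pair (∑ i, d i) v = -1) :
    ∃ (c : Fin r → ℝ) (w : Fin r → V n), (∀ j, 0 ≤ c j) ∧ ∑ j, c j = 1 ∧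
      v = ∑ j, c j • w j ∧ ∀ j, c j ≠ 0 →
        (w j ∈ polar (∑ i, D i) ∧ pair (∑ i, d i) (w j) = -1) ∧ supp (D j) (w j) = 1 := by
  obtain ⟨w, hw, hvw⟩ := h.decomp_right v
  have hsum := h.mem_polar_iff.1 hv
  have hge : ∀ j, -1 ≤ pair (∑ i, d i) (w j) := fun j =>
    h.mem_polar (hw j) _ (mem_sum_iff.2 ⟨d, hd, rfl⟩)
  have hle : ∀ j ∈ Finset.univ,
      -supp (D j) v ≤ supp (D j) v * pair (∑ i, d i) (w j) := fun j _ => by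
    nlinarith [h.supp_nonneg j v, hge j]
  have hexp : -1 = ∑ j, supp (D j) v * pair (∑ i, d i) (w j) := by
    rw [← hvd]
    conv_lhs => rw [hvw]
    rw [pair_sum_right]
    exact Finset.sum_congr rfl fun j _ => pair_smul_right _ _ _
  have hle' := Finset.sum_le_sum hle
  rw [Finset.sum_neg_distrib, ← hexp] at hle'
  have hone : ∑ j, supp (D j) v = 1 := by linarith
  have heq := (Finset.sum_eq_sum_iff_of_le hle).1 (by
    rw [Finset.sum_neg_distrib, ← hexp, hone])
  refine ⟨fun j => supp (D j) v, w, fun j => h.supp_nonneg j v, hone, hvw, fun j hj => ?_⟩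
  have hjpos : 0 < supp (D j) v := lt_of_le_of_ne (h.supp_nonneg j v) (Ne.symm hj)
  refine ⟨⟨h.mem_polar (hw j), ?_⟩, ?_⟩
  · have := heq j (Finset.mem_univ j)
    nlinarith
  · refine le_antisymm (by simpa using h.supp_le j (hw j)) ?_
    have h1 := supp_sum_smul_le (h.compact_left j) ⟨0, h.zero_left j⟩ Finset.univ
      (fun k _ => h.supp_nonneg k v) w
    rw [← hvw, Finset.sum_eq_single j] at h1
    · nlinarith
    · intro k _ hkj
      have h2 := h.supp_le j (hw k)
      rw [if_neg (Ne.symm hkj)] at h2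
      rw [le_antisymm h2 (h.supp_nonneg j _), mul_zero]
    · simp

theorem subset_of_chkMap_subset (h : NefDual D N) {F G : Set (V n)} (hF : F ∈ regularFaces D)
    (hG : G ∈ regularFaces D) (hFG : chkMap D F ⊆ chkMap D G) : F ⊆ G := by
  obtain ⟨hFf, hFn, ⟨_, hx⟩⟩ := hF
  obtain ⟨d, hd, rfl⟩ := h.exists_face_eq hFf hFn
  obtain ⟨e, he, rfl⟩ := h.exists_face_eq hG.1 hG.2.1
  obtain ⟨u, hu, -⟩ := mem_chkMap_iff.1 hx
  have hpart : ∀ j, ∀ w ∈ {v ∈ polar (∑ i, D i) | pair (∑ i, d i) v = -1},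
      supp (D j) w = 1 → pair (∑ i, e i) w = -1 := fun j w hw hwj => by
    have hmem : ∑ i, Function.update u j w i ∈
        chkMap D {v ∈ polar (∑ i, D i) | pair (∑ i, d i) v = -1} := by
      refine mem_chkMap_iff.2 ⟨_, fun i => ?_, rfl⟩
      rcases eq_or_ne i j with rfl | hij
      · rw [Function.update_self]; exact ⟨hw, hwj⟩
      · rw [Function.update_of_ne hij]; exact hu i
    have hge : ∀ i ∈ Finset.univ, -1 ≤ pair (∑ i, e i) (Function.update u j w i) := fun i _ => by
      have he' := mem_sum_iff.2 ⟨e, he, rfl⟩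
      rcases eq_or_ne i j with rfl | hij
      · rw [Function.update_self]; exact hw.1 _ he'
      · rw [Function.update_of_ne hij]; exact (hu i).1.1 _ he'
    obtain ⟨g, hg, hgsum⟩ := mem_chkMap_iff.1 (hFG hmem)
    have hval : ∑ i : Fin r, (-1 : ℝ) = ∑ i, pair (∑ i, e i) (Function.update u j w i) := by
      rw [← pair_sum_right, ← hgsum, pair_sum_right]
      exact Finset.sum_congr rfl fun i _ => (hg i).1.2.symm
    have := (Finset.sum_eq_sum_iff_of_le hge).1 hval j (Finset.mem_univ j)
    rw [Function.update_self] at this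
    exact this.symm
  rintro v ⟨hv, hvd⟩
  refine ⟨hv, ?_⟩
  obtain ⟨c, w, hc, hc1, hvw, hw⟩ := h.exists_convex_comb hd hv hvd
  rw [hvw, pair_sum_right, ← hc1, ← Finset.sum_neg_distrib]
  refine Finset.sum_congr rfl fun j _ => ?_
  rw [pair_smul_right]
  rcases eq_or_ne (c j) 0 with hj | hj
  · rw [hj]; simp
  · rw [hpart j _ (hw j hj).1 (hw j hj).2]; ring

theorem pair_eq_of_mem_face (h : NefDual D N) {d : Fin r → V n} (hd : ∀ i, d i ∈ D i)
    {v : V n} (hv : v ∈ polar (∑ i, D i)) (hvd : pair (∑ i, d i) v = -1) {j : Fin r}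
    (hj : supp (D j) v = 1) (i : Fin r) : pair (d i) v = -(if i = j then 1 else 0 : ℝ) := by
  refine ((Finset.sum_eq_sum_iff_of_le fun i _ =>
    h.pairing i j (d i) (hd i) v (h.mem_right hv hj)).1 ?_ i (Finset.mem_univ i)).symm
  rw [← pair_sum_left, hvd]
  simp

theorem mem_chkMap_dualFace (h : NefDual D N) {F : Set (V n)} {d : Fin r → V n}
    (hd : ∀ i, d i ∈ D i) (hF : F = {v ∈ polar (∑ i, D i) | pair (∑ i, d i) v = -1})
    (hne : (chkMap D F).Nonempty) : ∑ i, d i ∈ chkMap N (dualFace D N F) := by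
  subst hF
  refine mem_chkMap_iff.2 ⟨d, fun i => ⟨⟨h.symm.mem_polar (hd i), fun v hv => ?_⟩, ?_⟩, rfl⟩
  · obtain ⟨w, hw, rfl⟩ := mem_chkMap_iff.1 hv
    rw [pair_sum_right, Finset.sum_congr rfl fun j _ =>
      h.pair_eq_of_mem_face hd (hw j).1.1 (hw j).1.2 (hw j).2 i]
    simp
  · obtain ⟨_, hx⟩ := hne
    obtain ⟨u, hu, -⟩ := mem_chkMap_iff.1 hx
    refine le_antisymm (by simpa using h.symm.supp_le i (hd i)) ?_
    have h1 := neg_pair_le_supp (h.compact_right i) (h.mem_right (hu i).1.1 (hu i).2) (d i)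
    rwa [pair_comm, h.pair_eq_of_mem_face hd (hu i).1.1 (hu i).1.2 (hu i).2 i, if_pos rfl,
      neg_neg] at h1

theorem dualFace_mem (h : NefDual D N) {F : Set (V n)} (hF : F ∈ regularFaces D) :
    dualFace D N F ∈ regularFaces N := by
  obtain ⟨hFf, hFn, hne⟩ := hF
  obtain ⟨d, hd, hFd⟩ := h.exists_face_eq hFf hFn
  refine ⟨isFaceOf_setOf_pair_eq_neg_one fun m hm s hs => ?_, fun heq => ?_,
    ⟨_, h.mem_chkMap_dualFace hd hFd hne⟩⟩
  · obtain ⟨w, hw, rfl⟩ := mem_chkMap_iff.1 hs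
    rw [pair_comm]
    rw [hFd] at hw
    exact hm _ (mem_sum_iff.2 ⟨w, fun i => h.mem_right (hw i).1.1 (hw i).2, rfl⟩)
  · obtain ⟨v, hv⟩ := hne
    have h0 : (0 : V n) ∈ dualFace D N F := heq ▸ zero_mem_polar _
    have := h0.2 v hv
    rw [pair_zero_left] at this
    norm_num at this

theorem dualFace_dualFace (h : NefDual D N) {F : Set (V n)} (hF : F ∈ regularFaces D) :
    dualFace N D (dualFace D N F) = F := by
  obtain ⟨hFf, hFn, hne⟩ := hF
  obtain ⟨d, hd, hFd⟩ := h.exists_face_eq hFf hFn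
  apply Set.Subset.antisymm
  · rintro v ⟨hv, hvm⟩
    rw [hFd]
    refine ⟨hv, ?_⟩
    rw [pair_comm]
    exact hvm _ (h.mem_chkMap_dualFace hd hFd hne)
  obtain ⟨_, hx⟩ := hne
  obtain ⟨u, hu, -⟩ := mem_chkMap_iff.1 hx
  have hpart : ∀ j, ∀ w ∈ F, supp (D j) w = 1 → ∀ m ∈ chkMap N (dualFace D N F),
      pair w m = -1 := fun j w hw hwj m hm => by
    obtain ⟨g, hg, rfl⟩ := mem_chkMap_iff.1 hm
    have hup : ∀ i, Function.update u j w i ∈ F ∧ supp (D i) (Function.update u j w i) = 1 :=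
      fun i => by
        rcases eq_or_ne i j with rfl | hij
        · rw [Function.update_self]; exact ⟨hw, hwj⟩
        · rw [Function.update_of_ne hij]; exact hu i
    have hupN : ∀ i, Function.update u j w i ∈ N i := fun i => by
      have h1 := (hup i).1
      rw [hFd] at h1
      exact h.mem_right h1.1 (hup i).2
    have hgD : ∀ i, g i ∈ D i := fun i => h.symm.mem_right (hg i).1.1 (hg i).2
    have hgw : ∀ i, pair (g i) w = -(if i = j then 1 else 0 : ℝ) := fun i => by
      have hsum := (hg i).1.2 _ (mem_chkMap_iff.2 ⟨_, hup, rfl⟩)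
      rw [pair_sum_right] at hsum
      have := (Finset.sum_eq_sum_iff_of_le fun k _ =>
        h.pairing i k (g i) (hgD i) _ (hupN k)).1 (by rw [hsum]; simp) j (Finset.mem_univ j)
      rw [Function.update_self] at this
      exact this.symm
    rw [pair_comm, pair_sum_left, Finset.sum_congr rfl fun i _ => hgw i]
    simp
  intro v hv
  have hv' := hv
  rw [hFd] at hv'
  refine ⟨hv'.1, fun m hm => ?_⟩
  obtain ⟨c, w, hc, hc1, hvw, hw⟩ := h.exists_convex_comb hd hv'.1 hv'.2
  rw [hvw, pair_sum_left, ← hc1, ← Finset.sum_neg_distrib]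
  refine Finset.sum_congr rfl fun j _ => ?_
  rw [pair_smul_left]
  rcases eq_or_ne (c j) 0 with hj | hj
  · rw [hj]; simp
  · rw [hpart j _ (hFd ▸ (hw j hj).1) (hw j hj).2 m hm]; ring

theorem bijOn_dualFace (h : NefDual D N) :
    Set.BijOn (dualFace D N) (regularFaces D) (regularFaces N) :=
  Set.InvOn.bijOn (f' := dualFace N D)
    ⟨fun _ hF => h.dualFace_dualFace hF, fun _ hG => h.symm.dualFace_dualFace hG⟩
    (fun _ hF => h.dualFace_mem hF) fun _ hG => h.symm.dualFace_mem hG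

theorem dualFace_subset_dualFace_iff (h : NefDual D N) {F G : Set (V n)}
    (hF : F ∈ regularFaces D) (hG : G ∈ regularFaces D) :
    F ⊆ G ↔ dualFace D N G ⊆ dualFace D N F := by
  refine ⟨fun hFG => dualFace_anti D N hFG, fun hGF => ?_⟩
  rw [← h.dualFace_dualFace hF, ← h.dualFace_dualFace hG]
  exact dualFace_anti N D hGF

end NefDual

theorem IsLatticePolytope.isCompact {n : ℕ} {P : Set (V n)} (hP : IsLatticePolytope P) :
    IsCompact P := by
  obtain ⟨S, -, rfl⟩ := hP
  exact S.finite_toSet.isCompact_convexHull ℝ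

theorem IsLatticePolytope.convex {n : ℕ} {P : Set (V n)} (hP : IsLatticePolytope P) :
    Convex ℝ P := by
  obtain ⟨S, -, rfl⟩ := hP
  exact convex_convexHull ℝ _

theorem sum_supp_pos {n r : ℕ} {D : Fin r → Set (V n)} (hD : ∀ i, IsCompact (D i))
    (h0 : (0 : V n) ∈ interior (∑ i, D i)) {v : V n} (hv : v ≠ 0) :
    0 < ∑ i, supp (D i) v := by
  have hnhds : ∀ᶠ m in nhds (0 : V n), m ∈ ∑ i, D i := mem_interior_iff_mem_nhds.1 h0
  have htend : Filter.Tendsto (fun ε : ℝ => (-ε) • v) (nhdsWithin 0 (Set.Ioi 0)) (nhds 0) := by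
    have : Continuous fun ε : ℝ => (-ε) • v := by fun_prop
    simpa using (this.tendsto 0).mono_left nhdsWithin_le_nhds
  obtain ⟨ε, hε, hpos⟩ := ((htend.eventually hnhds).and self_mem_nhdsWithin).exists
  obtain ⟨d, hd, hdsum⟩ := mem_sum_iff.1 hε
  have h1 : -(pair (∑ i, d i) v) ≤ ∑ i, supp (D i) v := by
    rw [pair_sum_left, ← Finset.sum_neg_distrib]
    exact Finset.sum_le_sum fun i _ => neg_pair_le_supp (hD i) (hd i) v
  rw [hdsum, pair_smul_left] at h1
  have hvv : 0 < pair v v :=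
    lt_of_le_of_ne (Finset.sum_nonneg fun i _ => mul_self_nonneg (v i))
      (fun h => hv (dotProduct_self_eq_zero.1 h.symm))
  have : 0 < ε * pair v v := mul_pos hpos hvv
  linarith

/-- If `v` is scaled to lie on the boundary of the polar dual of `∑ᵢ Dᵢ`, then it is a convex
combination of vertices along which all support functions of the nef-partition are linear. -/
theorem exists_linear_comb {n r : ℕ} {D : Fin r → Set (V n)} (hD : ∀ i, IsCompact (D i))
    (hne : ∀ i, (D i).Nonempty) {E : Finset (V n)}
    (hE : polar (∑ i, D i) = convexHull ℝ (E : Set (V n))) {v : V n}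
    (hv : ∑ i, supp (D i) v = 1) :
    ∃ c : V n → ℝ, (∀ e ∈ E, 0 ≤ c e) ∧ ∑ e ∈ E, c e • e = v ∧
      (∀ j, supp (D j) v = ∑ e ∈ E, c e * supp (D j) e) ∧
      ∀ e ∈ E, c e * ∑ j, supp (D j) e = c e := by
  have hvE : v ∈ convexHull ℝ (E : Set (V n)) :=
    hE ▸ (mem_polar_sum_iff hD hne).2 hv.le
  obtain ⟨c, hc, hc1, hcv⟩ := Finset.mem_convexHull'.1 hvE
  have hle : ∀ j ∈ Finset.univ, supp (D j) v ≤ ∑ e ∈ E, c e * supp (D j) e := fun j _ => by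
    have := supp_sum_smul_le (hD j) (hne j) E hc (fun e => e)
    rwa [hcv] at this
  have hle' : ∀ e ∈ E, c e * ∑ j, supp (D j) e ≤ c e := fun e he =>
    mul_le_of_le_one_right (hc e he)
      ((mem_polar_sum_iff hD hne).1 (hE ▸ subset_convexHull ℝ _ he))
  have hsum : ∑ j, ∑ e ∈ E, c e * supp (D j) e = ∑ e ∈ E, c e * ∑ j, supp (D j) e := by
    rw [Finset.sum_comm]
    exact Finset.sum_congr rfl fun e _ => (Finset.mul_sum _ _ _).symm
  have h1 := Finset.sum_le_sum hle
  have h2 := Finset.sum_le_sum hle'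
  rw [hv, hsum] at h1
  rw [hc1] at h2
  refine ⟨c, hc, hcv, fun j => ?_, ?_⟩
  · exact (Finset.sum_eq_sum_iff_of_le hle).1 (by linarith) j (Finset.mem_univ j)
  · exact (Finset.sum_eq_sum_iff_of_le hle').1 (by linarith)

theorem nefDual_of_nefPartition {n r : ℕ} {D Nb : Fin r → Set (V n)}
    (hD : ∀ i, IsCompact (D i)) (hDc : ∀ i, Convex ℝ (D i))
    (h0 : (0 : V n) ∈ interior (∑ i, D i)) {E : Finset (V n)}
    (hE : polar (∑ i, D i) = convexHull ℝ (E : Set (V n)))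
    (hnef : ∀ i, ∀ e ∈ E, supp (D i) e = 0 ∨ supp (D i) e = 1)
    (hNb : ∀ i, Nb i = convexHull ℝ ({0} ∪ {e : V n | e ∈ E ∧ supp (D i) e = 1})) :
    NefDual D Nb := by
  have hne : ∀ i, (D i).Nonempty := fun i => by
    obtain ⟨d, hd, -⟩ := mem_sum_iff.1 (interior_subset h0)
    exact ⟨d i, hd i⟩
  have hnef0 : ∀ i, ∀ e ∈ E, 0 ≤ supp (D i) e := fun i e he => by
    rcases hnef i e he with h | h <;> rw [h]
    exact zero_le_one
  have hNc : ∀ i, Convex ℝ (Nb i) := fun i => hNb i ▸ convex_convexHull ℝ _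
  have hN0 : ∀ i, (0 : V n) ∈ Nb i := fun i =>
    hNb i ▸ subset_convexHull ℝ _ (Or.inl rfl)
  have hNE : ∀ i, ∀ e ∈ E, supp (D i) e = 1 → e ∈ Nb i := fun i e he hei =>
    hNb i ▸ subset_convexHull ℝ _ (Or.inr ⟨he, hei⟩)
  have hNk : ∀ i, IsCompact (Nb i) := fun i => by
    rw [hNb]
    refine Set.Finite.isCompact_convexHull ℝ ((Set.finite_singleton 0).union ?_)
    exact E.finite_toSet.subset fun e he => he.1
  have hscale : ∀ v : V n, v ≠ 0 →
      ∃ (t : ℝ) (c : V n → ℝ), 0 < t ∧ (∀ e ∈ E, 0 ≤ c e) ∧ ∑ e ∈ E, c e • e = t⁻¹ • v ∧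
      (∀ j, t⁻¹ * supp (D j) v = ∑ e ∈ E, c e * supp (D j) e) ∧
      ∀ e ∈ E, c e * ∑ j, supp (D j) e = c e := fun v hv => by
    have ht := sum_supp_pos hD h0 hv
    have hs : ∀ j, supp (D j) ((∑ i, supp (D i) v)⁻¹ • v) =
        (∑ i, supp (D i) v)⁻¹ * supp (D j) v := fun j =>
      supp_smul (hD j) (hne j) (inv_nonneg.2 ht.le) v
    obtain ⟨c, hc, hcv, hcs, hce⟩ := exists_linear_comb hD hne hE
      (v := (∑ i, supp (D i) v)⁻¹ • v) (by
        simp_rw [hs]; rw [← Finset.mul_sum, inv_mul_cancel₀ ht.ne'])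
    exact ⟨_, c, ht, hc, hcv, fun j => (hs j).symm.trans (hcs j), hce⟩
  have hsupp0 : ∀ j, ∀ v, 0 ≤ supp (D j) v := fun j v => by
    rcases eq_or_ne v 0 with rfl | hv
    · obtain ⟨m, -, hm⟩ := exists_neg_pair_eq_supp (hD j) (hne j) 0
      rw [← hm, pair_zero_right, neg_zero]
    · obtain ⟨t, c, ht, hc, -, hcs, -⟩ := hscale v hv
      refine nonneg_of_mul_nonneg_right ?_ (inv_pos.2 ht)
      rw [hcs]
      exact Finset.sum_nonneg fun e he => mul_nonneg (hc e he) (hnef0 j e he)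
  have hdecV : ∀ v, ∃ w : Fin r → V n, (∀ j, w j ∈ Nb j) ∧ v = ∑ j, supp (D j) v • w j := by
    intro v
    rcases eq_or_ne v 0 with rfl | hv
    · exact ⟨0, hN0, by simp⟩
    obtain ⟨t, c, ht, hc, hcv, hcs, hce⟩ := hscale v hv
    have hpart : ∀ j, ∃ w ∈ Nb j,
        ∑ e ∈ E, (c e * supp (D j) e) • e = (t⁻¹ * supp (D j) v) • w := fun j => by
      have hcnn : ∀ e ∈ E, 0 ≤ c e * supp (D j) e := fun e he =>
        mul_nonneg (hc e he) (hnef0 j e he)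
      rcases eq_or_ne (t⁻¹ * supp (D j) v) 0 with hz | hz
      · refine ⟨0, hN0 j, ?_⟩
        rw [smul_zero]
        refine Finset.sum_eq_zero fun e he => ?_
        rw [(Finset.sum_eq_zero_iff_of_nonneg hcnn).1 ((hcs j).symm.trans hz) e he, zero_smul]
      · refine ⟨∑ e ∈ E, ((t⁻¹ * supp (D j) v)⁻¹ * (c e * supp (D j) e)) •
          (if supp (D j) e = 1 then e else 0), ?_, ?_⟩
        · refine (hNc j).sum_mem (fun e he => ?_) ?_ (fun e he => ?_)
          · refine mul_nonneg (inv_nonneg.2 ?_) (hcnn e he)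
            exact mul_nonneg (inv_nonneg.2 ht.le) (hsupp0 j v)
          · rw [← Finset.mul_sum, ← hcs, inv_mul_cancel₀ hz]
          · split_ifs with hej
            · exact hNE j e he hej
            · exact hN0 j
        · rw [Finset.smul_sum]
          refine Finset.sum_congr rfl fun e he => ?_
          rw [smul_smul, mul_inv_cancel_left₀ hz]
          rcases hnef j e he with hej | hej <;> simp [hej]
    choose w hw hwsum using hpart
    refine ⟨w, hw, ?_⟩
    have hsum : t⁻¹ • v = t⁻¹ • ∑ j, supp (D j) v • w j := by
      rw [Finset.smul_sum, ← hcv, Finset.sum_congr rfl fun j _ =>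
        (smul_smul t⁻¹ (supp (D j) v) (w j)).trans (hwsum j).symm, Finset.sum_comm]
      refine Finset.sum_congr rfl fun e he => ?_
      rw [← Finset.sum_smul, ← Finset.mul_sum, hce e he]
    exact smul_right_injective _ (inv_ne_zero ht.ne') hsum
  have hpairing : ∀ i j, ∀ m ∈ D i, ∀ v ∈ Nb j, -(if i = j then 1 else 0 : ℝ) ≤ pair m v := by
    intro i j m hm v hv
    rw [hNb] at hv
    have hconv : Convex ℝ {v : V n | -(if i = j then 1 else 0 : ℝ) ≤ pair m v} := by
      simp_rw [pair_comm m]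
      exact convex_halfSpace_ge (pairCLM m).isLinear _
    refine convexHull_min ?_ hconv hv
    rintro e (rfl | ⟨he, hej⟩)
    · rw [Set.mem_ofPred_eq, pair_zero_right]
      split_ifs <;> norm_num
    · have h1 := neg_pair_le_supp (hD i) hm e
      have h2 : supp (D i) e ≤ if i = j then 1 else 0 := by
        split_ifs with hij
        · rw [hij, hej]
        · have h3 := (mem_polar_sum_iff hD hne).1 (hE ▸ subset_convexHull ℝ _ he)
          have h4 : ∑ k ∈ {i, j}, supp (D k) e ≤ ∑ k, supp (D k) e :=
            Finset.sum_le_sum_of_subset_of_nonneg (Finset.subset_univ _)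
              fun k _ _ => hnef0 k e he
          rw [Finset.sum_pair hij, hej] at h4
          linarith
      rw [Set.mem_ofPred_eq]
      linarith
  refine ⟨hD, hNk, hDc, hNc, fun i => ?_, hN0, hpairing, fun m => ?_, hdecV⟩
  · refine mem_of_forall_exists_pair_le (hD i) (hDc i) fun v => ?_
    obtain ⟨k, hk, hkv⟩ := exists_neg_pair_eq_supp (hD i) (hne i) v
    refine ⟨k, hk, ?_⟩
    rw [pair_zero_left]
    linarith [hsupp0 i v]
  · have hlin : IsLinearMap ℝ fun d : Fin r → V n => ∑ j, supp (Nb j) m • d j :=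
      ⟨fun a b => by simp [Finset.sum_add_distrib], fun c a => by
        simp only [Pi.smul_apply, Finset.smul_sum]
        exact Finset.sum_congr rfl fun j _ => smul_comm _ _ _⟩
    have hcont : Continuous fun d : Fin r → V n => ∑ j, supp (Nb j) m • d j := by fun_prop
    have hmem : m ∈ (fun d : Fin r → V n => ∑ j, supp (Nb j) m • d j) '' Set.univ.pi D := by
      refine mem_of_forall_exists_pair_le ((isCompact_univ_pi hD).image hcont)
        ((convex_pi fun i _ => hDc i).is_linear_image hlin) fun v => ?_
      choose d hd hdv using fun i => exists_neg_pair_eq_supp (hD i) (hne i) v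
      refine ⟨_, ⟨d, fun i _ => hd i, rfl⟩, ?_⟩
      obtain ⟨w, hw, hvw⟩ := hdecV v
      have h1 : pair m v = ∑ j, supp (D j) v * pair m (w j) := by
        conv_lhs => rw [hvw]
        rw [pair_sum_right]
        exact Finset.sum_congr rfl fun j _ => pair_smul_right _ _ _
      rw [h1]
      simp only [pair_sum_left, pair_smul_left]
      refine Finset.sum_le_sum fun j _ => ?_
      have h2 := neg_pair_le_supp (hNk j) (hw j) m
      rw [pair_comm] at h2
      rw [← neg_neg (pair (d j) v), hdv]
      nlinarith [hsupp0 j v]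
    obtain ⟨d, hd, hdm⟩ := hmem
    exact ⟨d, fun j => hd j (Set.mem_univ j), hdm.symm⟩

theorem stmt6 {n r : ℕ} (Δ : Set (V n)) (D : Fin r → Set (V n))
    (hΔrefl : IsReflexive Δ)
    (hDlat : ∀ i, IsLatticePolytope (D i))
    (hΔ : Δ = ∑ i, D i)
    (E : Finset (V n))
    (hE : (E : Set (V n)) = Set.extremePoints ℝ (polar Δ))
    (hnef : ∀ i, ∀ e ∈ E, supp (D i) e = 0 ∨ supp (D i) e = 1)
    (Nb : Fin r → Set (V n))
    (hNb : ∀ i, Nb i = convexHull ℝ ({0} ∪ {e : V n | e ∈ E ∧ supp (D i) e = 1}))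
    -- R_{Δ*}: proper faces σ* of Δ* with σ̌ ≠ ∅
    (RΔ : Set (Set (V n)))
    (hRΔ : RΔ = {F | IsFaceOf F (polar Δ) ∧ F ≠ polar Δ ∧ (chkMap D F).Nonempty})
    -- P_∇: the faces σ̌ of ∇ arising this way
    (Pnab : Set (Set (V n)))
    (hPnab : Pnab = chkMap D '' RΔ)
    -- R_{∇*}: defined symmetrically, interchanging the roles of Δ and ∇
    (Rnab : Set (Set (V n)))
    (hRnab : Rnab = {G | IsFaceOf G (polar (∑ i, Nb i)) ∧ G ≠ polar (∑ i, Nb i) ∧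
        (chkMap Nb G).Nonempty})
    -- the map σ* ↦ σ̌* = {m ∈ ∇* | ⟨m, σ̌⟩ = -1}
    (dstar : Set (V n) → Set (V n))
    (hdstar : ∀ F, dstar F = {m ∈ polar (∑ i, Nb i) | ∀ v ∈ chkMap D F, pair m v = -1}) :
    -- σ* ↦ σ̌ is an order-preserving bijection R_{Δ*} → P_∇
    Set.BijOn (chkMap D) RΔ Pnab ∧
    (∀ F ∈ RΔ, ∀ G ∈ RΔ, (F ⊆ G ↔ chkMap D F ⊆ chkMap D G)) ∧
    -- σ* ↦ σ̌* is an order-reversing bijection R_{Δ*} → R_{∇*}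
    Set.BijOn dstar RΔ Rnab ∧
    (∀ F ∈ RΔ, ∀ G ∈ RΔ, (F ⊆ G ↔ dstar G ⊆ dstar F)) := by
  subst hΔ hPnab
  have hEhull : polar (∑ i, D i) = convexHull ℝ (E : Set (V n)) := by
    rw [← closure_convexHull_extremePoints hΔrefl.2.2.isCompact hΔrefl.2.2.convex, ← hE]
    exact (E.finite_toSet.isClosed_convexHull ℝ).closure_eq
  have h : NefDual D Nb := nefDual_of_nefPartition (fun i => (hDlat i).isCompact)
    (fun i => (hDlat i).convex) hΔrefl.2.1 hEhull hnef hNb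
  obtain rfl : RΔ = regularFaces D := hRΔ
  obtain rfl : Rnab = regularFaces Nb := hRnab
  obtain rfl : dstar = dualFace D Nb := funext hdstar
  have hiff : ∀ F ∈ regularFaces D, ∀ G ∈ regularFaces D,
      (F ⊆ G ↔ chkMap D F ⊆ chkMap D G) := fun F hF G hG =>
    ⟨chkMap_mono D, h.subset_of_chkMap_subset hF hG⟩
  refine ⟨Set.InjOn.bijOn_image fun F hF G hG hFG => ?_, hiff, h.bijOn_dualFace,
    fun F hF G hG => h.dualFace_subset_dualFace_iff hF hG⟩
  exact Set.Subset.antisymm ((hiff F hF G hG).2 hFG.subset) ((hiff G hG F hF).2 hFG.symm.subset)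

end BB
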